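/- (Brianchon–Gram) Let P ⊂ ℝ^d be a full-dimensional polytope. Then for every z ∈ ℝ^d, Σ_F (−1)^{dim F} · 1_{K_F}(z) = 1_P(z), where the sum runs over all nonempty faces F of P (including P itself, whose tangent cone is ℝ^d) and K_F denotes the tangent cone of F; equivalently, [P] = Σ_{∅ ≠ F face of P} (−1)^{dim F} [K_F] as functions on ℝ^d. -/

import Mathlib

open scoped BigOperators Classical

noncomputable section

/-- The real vector corresponding to an integer vector. -/
def toR (d : ℕ) (m : Fin d → ℤ) : Fin d → ℝ := fun i => (m i : ℝ)

/-- The standard dot product on `ℝ^d`. -/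
def dotR (d : ℕ) (x y : Fin d → ℝ) : ℝ := ∑ i, x i * y i

/-- Laurent polynomials `ℂ[x₁^{±1},…,x_d^{±1}]`, represented by their coefficient functions. -/
abbrev LaurentPoly (d : ℕ) := (Fin d → ℤ) →₀ ℂ

/-- The integer-point generating series of a subset of `ℝ^d`: the function `ℤ^d → ℂ`
equal to `1` on `S ∩ ℤ^d` and `0` elsewhere. -/
def genSeries (d : ℕ) (S : Set (Fin d → ℝ)) : (Fin d → ℤ) → ℂ :=
  fun m => if toR d m ∈ S then 1 else 0

/-- The action of a Laurent polynomial on a formal Laurent series,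
`(x^w · S)(m) = S(m - w)` extended linearly. -/
def actLP (d : ℕ) (g : LaurentPoly d) (S : (Fin d → ℤ) → ℂ) : (Fin d → ℤ) → ℂ :=
  fun m => ∑ w ∈ g.support, g w * S (m - w)

/-- The series of a Laurent polynomial `f`, i.e. `Σ_m f_m x^m` as a formal series. -/
def seriesOf (d : ℕ) (f : LaurentPoly d) : (Fin d → ℤ) → ℂ := fun m => f m

/-- The cone `v + ℝ_{≥0} w₁ + ⋯ + ℝ_{≥0} w_n`. -/
def coneSet (d n : ℕ) (v : Fin d → ℝ) (w : Fin n → Fin d → ℤ) : Set (Fin d → ℝ) :=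
  {y | ∃ lam : Fin n → ℝ, (∀ i, 0 ≤ lam i) ∧ y = v + ∑ i, lam i • toR d (w i)}

/-- The fundamental half-open parallelepiped `{v + Σ λᵢ wᵢ : 0 ≤ λᵢ < 1}`. -/
def parSet (d : ℕ) (v : Fin d → ℝ) (w : Fin d → Fin d → ℤ) : Set (Fin d → ℝ) :=
  {y | ∃ lam : Fin d → ℝ, (∀ i, 0 ≤ lam i ∧ lam i < 1) ∧ y = v + ∑ i, lam i • toR d (w i)}

/-- A simple rational cone: `v + ℝ_{≥0} w₁ + ⋯ + ℝ_{≥0} w_d` with `w₁,…,w_d ∈ ℤ^d`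
linearly independent. -/
def IsSimpleCone (d : ℕ) (K : Set (Fin d → ℝ)) : Prop :=
  ∃ (v : Fin d → ℝ) (w : Fin d → Fin d → ℤ),
    LinearIndependent ℝ (fun i => toR d (w i)) ∧ K = coneSet d d v w

/-- Membership in the module `PL` of polyhedral Laurent series: a finite
`ℂ[x₁^{±1},…,x_d^{±1}]`-linear combination of the series of simple rational cones. -/
def MemPL (d : ℕ) (S : (Fin d → ℤ) → ℂ) : Prop :=
  ∃ (n : ℕ) (g : Fin n → LaurentPoly d) (K : Fin n → Set (Fin d → ℝ)),
    (∀ i, IsSimpleCone d (K i)) ∧ S = ∑ i, actLP d (g i) (genSeries d (K i))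

/-- The field of rational functions `ℂ(x₁,…,x_d)`. -/
abbrev RatF (d : ℕ) := FractionRing (MvPolynomial (Fin d) ℂ)

/-- The monomial `x^w`, `w ∈ ℤ^d`, as a rational function. -/
def ratMon (d : ℕ) (w : Fin d → ℤ) : RatF d :=
  ∏ i, (algebraMap (MvPolynomial (Fin d) ℂ) (RatF d) (MvPolynomial.X i)) ^ (w i)

/-- A Laurent polynomial as a rational function. -/
def toRat (d : ℕ) (g : LaurentPoly d) : RatF d :=
  ∑ w ∈ g.support, algebraMap (MvPolynomial (Fin d) ℂ) (RatF d) (MvPolynomial.C (g w)) * ratMon d w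

/-- `σ_S(x) = Σ_{m ∈ S ∩ ℤ^d} x^m`, as a rational function (for `S` with finitely many
integer points). -/
def sigmaSet (d : ℕ) (S : Set (Fin d → ℝ)) : RatF d :=
  ∑ᶠ m ∈ {m : Fin d → ℤ | toR d m ∈ S}, ratMon d m

/-- `φ : PL → ℂ(x₁,…,x_d)` is the `ℂ[x₁^{±1},…,x_d^{±1}]`-module homomorphism sending the
series `S_K` of a simple rational cone `K` to `σ_{P_K}(x) / Π (1 - x^{wᵢ})`. -/
def IsPhi (d : ℕ) (φ : ((Fin d → ℤ) → ℂ) → RatF d) : Prop :=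
  (∀ S T, MemPL d S → MemPL d T → φ (S + T) = φ S + φ T) ∧
  (∀ (g : LaurentPoly d) (S), MemPL d S → φ (actLP d g S) = toRat d g * φ S) ∧
  (∀ (v : Fin d → ℝ) (w : Fin d → Fin d → ℤ),
      LinearIndependent ℝ (fun i => toR d (w i)) →
      φ (genSeries d (coneSet d d v w)) =
        sigmaSet d (parSet d v w) / ∏ i, (1 - ratMon d (w i)))

/-- A convex polyhedron: an intersection of finitely many closed halfspaces. -/
def IsPolyhedron (d : ℕ) (P : Set (Fin d → ℝ)) : Prop :=
  ∃ (n : ℕ) (a : Fin n → Fin d → ℝ) (b : Fin n → ℝ),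
    P = {y | ∀ i, dotR d (a i) y ≤ b i}

/-- The polar `P^∨ = {x : ⟨x,y⟩ ≤ 1 for all y ∈ P}`. -/
def polar (d : ℕ) (P : Set (Fin d → ℝ)) : Set (Fin d → ℝ) :=
  {x | ∀ y ∈ P, dotR d x y ≤ 1}

section RelOpen

variable {E F : Type*} [AddCommGroup E] [Module ℝ E] [AddCommGroup F] [Module ℝ F]

/-- A convex set in which every segment can be prolonged a little beyond its endpoints, that is,
a relatively open convex set, described without a topology. -/
structure IsRelOpenConvex (C : Set E) : Prop where
  convex : Convex ℝ C
  prolong : ∀ x ∈ C, ∀ y ∈ C, ∃ ε : ℝ, 0 < ε ∧ x + ε • (x - y) ∈ C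

/-- A set containing a small segment around each of its points in every direction. -/
def IsAlgOpen (U : Set E) : Prop :=
  ∀ x ∈ U, ∀ w : E, ∃ ε : ℝ, 0 < ε ∧ ∀ δ : ℝ, |δ| ≤ ε → x + δ • w ∈ U

theorem Convex.add_smul_mem_of_abs_le {C : Set E} (hC : Convex ℝ C) {x w : E} {a b : ℝ}
    (ha : 0 < a) (hb : 0 < b) (h₁ : x + a • w ∈ C) (h₂ : x - b • w ∈ C) {δ : ℝ}
    (hδ : |δ| ≤ min a b) : x + δ • w ∈ C := by
  have hδa := (abs_le.1 (hδ.trans (min_le_left _ _))).2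
  have hδb := (abs_le.1 (hδ.trans (min_le_right _ _))).1
  have hab : 0 < a + b := by positivity
  have := hC h₁ h₂ (a := (δ + b) / (a + b)) (b := (a - δ) / (a + b))
    (div_nonneg (by linarith) hab.le) (div_nonneg (by linarith) hab.le)
    (by field_simp; ring)
  convert this using 1
  match_scalars <;> field_simp <;> ring

theorem IsRelOpenConvex.add_smul_mem {C : Set E} (hC : IsRelOpenConvex C) {x : E} (hx : x ∈ C)
    {w : E} (hw : w ∈ vectorSpan ℝ C) :
    ∃ ε : ℝ, 0 < ε ∧ ∀ δ : ℝ, |δ| ≤ ε → x + δ • w ∈ C := by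
  rw [vectorSpan_eq_span_vsub_set_right ℝ hx] at hw
  induction hw using Submodule.span_induction with
  | mem w hw =>
    obtain ⟨y, hy, rfl⟩ := hw
    obtain ⟨ε, hε, h⟩ := hC.prolong x hx y hy
    refine ⟨min 1 ε, by positivity, fun δ hδ => ?_⟩
    refine hC.convex.add_smul_mem_of_abs_le one_pos hε ?_ ?_ hδ
    · simpa using hy
    · convert h using 1
      simp only [vsub_eq_sub]
      module
  | zero => exact ⟨1, one_pos, fun δ _ => by simpa using hx⟩
  | add w₁ w₂ _ _ h₁ h₂ =>
    obtain ⟨ε₁, hε₁, h₁⟩ := h₁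
    obtain ⟨ε₂, hε₂, h₂⟩ := h₂
    refine ⟨min ε₁ ε₂ / 2, by positivity, fun δ hδ => ?_⟩
    have h2 : |2 * δ| ≤ min ε₁ ε₂ := by
      rw [abs_mul, abs_two]; linarith
    have := hC.convex (h₁ _ (h2.trans (min_le_left _ _))) (h₂ _ (h2.trans (min_le_right _ _)))
      (a := 1 / 2) (b := 1 / 2) (by norm_num) (by norm_num) (by norm_num)
    convert this using 1
    module
  | smul c w _ h =>
    obtain ⟨ε, hε, h⟩ := h
    refine ⟨ε / (|c| + 1), by positivity, fun δ hδ => ?_⟩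
    rw [smul_smul]
    refine h _ ?_
    rw [le_div_iff₀ (by positivity)] at hδ
    rw [abs_mul]
    nlinarith [abs_nonneg δ]

theorem IsRelOpenConvex.image {C : Set E} (hC : IsRelOpenConvex C) (f : E →ₗ[ℝ] F) :
    IsRelOpenConvex (f '' C) where
  convex := hC.convex.linear_image f
  prolong := by
    rintro _ ⟨x, hx, rfl⟩ _ ⟨y, hy, rfl⟩
    obtain ⟨ε, hε, h⟩ := hC.prolong x hx y hy
    exact ⟨ε, hε, _, h, by simp⟩

theorem IsRelOpenConvex.fiber {C : Set E} (hC : IsRelOpenConvex C) (x v : E) :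
    IsRelOpenConvex {t : ℝ | x + t • v ∈ C} where
  convex := by
    intro s hs t ht a b ha hb hab
    have := hC.convex hs ht ha hb hab
    simp only [Set.mem_ofPred_eq] at *
    convert this using 1
    obtain rfl : b = 1 - a := by linarith
    module
  prolong := by
    intro s hs t ht
    obtain ⟨ε, hε, h⟩ := hC.prolong _ hs _ ht
    refine ⟨ε, hε, ?_⟩
    simp only [Set.mem_ofPred_eq]
    convert h using 1
    module

theorem IsAlgOpen.isRelOpenConvex {U : Set E} (hU : IsAlgOpen U) (hc : Convex ℝ U) :
    IsRelOpenConvex U where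
  convex := hc
  prolong x hx y _ := by
    obtain ⟨ε, hε, h⟩ := hU x hx (x - y)
    exact ⟨ε, hε, h ε (abs_of_pos hε).le⟩

theorem IsRelOpenConvex.inter {C U : Set E} (hC : IsRelOpenConvex C) (hU : IsAlgOpen U)
    (hc : Convex ℝ U) : IsRelOpenConvex (C ∩ U) where
  convex := hC.convex.inter hc
  prolong := by
    rintro x ⟨hx, hxU⟩ y ⟨hy, -⟩
    obtain ⟨ε₁, hε₁, h₁⟩ := hC.add_smul_mem hx (vsub_mem_vectorSpan ℝ hx hy)
    obtain ⟨ε₂, hε₂, h₂⟩ := hU x hxU (x - y)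
    have h := abs_of_pos (lt_min hε₁ hε₂)
    exact ⟨min ε₁ ε₂, lt_min hε₁ hε₂, h₁ _ (h.trans_le (min_le_left _ _)),
      h₂ _ (h.trans_le (min_le_right _ _))⟩

theorem mem_vectorSpan_of_add_smul_mem {C : Set E} {x w : E} (hx : x ∈ C) {ε : ℝ} (hε : 0 < ε)
    (h : x + ε • w ∈ C) : w ∈ vectorSpan ℝ C := by
  have := vsub_mem_vectorSpan ℝ h hx
  rw [vsub_eq_sub, add_sub_cancel_left] at this
  exact (Submodule.smul_mem_iff _ hε.ne').1 this

theorem IsRelOpenConvex.vectorSpan_inter {C U : Set E} (hC : IsRelOpenConvex C)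
    (hU : IsAlgOpen U) (h : (C ∩ U).Nonempty) : vectorSpan ℝ (C ∩ U) = vectorSpan ℝ C := by
  refine le_antisymm (vectorSpan_mono ℝ Set.inter_subset_left) fun w hw => ?_
  obtain ⟨x, hx, hxU⟩ := h
  obtain ⟨ε₁, hε₁, h₁⟩ := hC.add_smul_mem hx hw
  obtain ⟨ε₂, hε₂, h₂⟩ := hU x hxU w
  have h := abs_of_pos (lt_min hε₁ hε₂)
  exact mem_vectorSpan_of_add_smul_mem ⟨hx, hxU⟩ (lt_min hε₁ hε₂)
    ⟨h₁ _ (h.trans_le (min_le_left _ _)), h₂ _ (h.trans_le (min_le_right _ _))⟩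

theorem IsAlgOpen.vectorSpan_eq_top {U : Set E} (hU : IsAlgOpen U) (h : U.Nonempty) :
    vectorSpan ℝ U = ⊤ := by
  obtain ⟨x, hx⟩ := h
  refine eq_top_iff.2 fun w _ => ?_
  obtain ⟨ε, hε, h⟩ := hU x hx w
  exact mem_vectorSpan_of_add_smul_mem hx hε (h ε (abs_of_pos hε).le)

end RelOpen

section Line

open Filter Topology

/-- The Euler characteristic with compact support of a relatively open convex subset of `ℝ`. -/
def lineEuler (I : Set ℝ) : ℝ :=
  if I = ∅ then 0 else if I.Subsingleton then 1 else -1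

theorem Convex.mem_of_le_of_le {I : Set ℝ} (hI : Convex ℝ I) {a b t : ℝ} (ha : a ∈ I) (hb : b ∈ I)
    (hat : a ≤ t) (htb : t ≤ b) : t ∈ I :=
  hI.ordConnected.out ha hb ⟨hat, htb⟩

theorem Convex.eventually_nhdsGT {I : Set ℝ} (hI : Convex ℝ I) (x : ℝ) :
    (∀ᶠ t in 𝓝[>] x, t ∈ I) ∨ ∀ᶠ t in 𝓝[>] x, t ∉ I := by
  by_contra h
  obtain ⟨h₁, h₂⟩ := not_or.1 h
  simp only [not_eventually, not_not] at h₁ h₂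
  obtain ⟨y, hy, hxy⟩ := (h₂.and_eventually self_mem_nhdsWithin).exists
  obtain ⟨t, ht, hxt, hty⟩ := (h₁.and_eventually (Ioo_mem_nhdsGT hxy)).exists
  obtain ⟨s, hs, _, hst⟩ := (h₂.and_eventually (Ioo_mem_nhdsGT hxt)).exists
  exact ht (hI.mem_of_le_of_le hs hy hst.le hty.le)

theorem Convex.eventually_atBot {I : Set ℝ} (hI : Convex ℝ I) :
    (∀ᶠ t in atBot, t ∈ I) ∨ ∀ᶠ t in atBot, t ∉ I := by
  by_contra h
  obtain ⟨h₁, h₂⟩ := not_or.1 h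
  simp only [not_eventually, not_not] at h₁ h₂
  obtain ⟨y, hy⟩ := h₂.exists
  obtain ⟨t, ht, hty⟩ := (h₁.and_eventually (eventually_le_atBot y)).exists
  obtain ⟨s, hs, hst⟩ := (h₂.and_eventually (eventually_le_atBot t)).exists
  exact ht (hI.mem_of_le_of_le hs hy hst hty)

theorem sum_mul_ite_eventually {ι : Type*} (s : Finset ι) (I : ι → Set ℝ) (c : ι → ℝ)
    (f : Filter ℝ) [f.NeBot]
    (hf : ∀ i ∈ s, (∀ᶠ t in f, t ∈ I i) ∨ ∀ᶠ t in f, t ∉ I i)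
    (h : ∀ t, ∑ i ∈ s, c i * (if t ∈ I i then 1 else 0) = 0) :
    ∑ i ∈ s, c i * (if ∀ᶠ t in f, t ∈ I i then 1 else 0) = 0 := by
  have key : ∀ᶠ t in f, ∀ i ∈ s, (t ∈ I i ↔ ∀ᶠ t in f, t ∈ I i) := by
    rw [Filter.eventually_all_finset]
    intro i hi
    rcases hf i hi with h' | h'
    · filter_upwards [h'] with t ht using ⟨fun _ => h', fun _ => ht⟩
    · filter_upwards [h'] with t ht
      refine ⟨fun h => absurd h ht, fun h'' => ?_⟩
      obtain ⟨u, hu, hu'⟩ := (h''.and h').exists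
      exact absurd hu hu'
  obtain ⟨t, ht⟩ := key.exists
  refine Eq.trans (Finset.sum_congr rfl fun i hi => ?_) (h t)
  simp only [ht i hi]

theorem IsRelOpenConvex.isOpen_of_not_subsingleton {I : Set ℝ} (hI : IsRelOpenConvex I)
    (h : ¬ I.Subsingleton) : IsOpen I := by
  rw [Set.not_subsingleton_iff] at h
  obtain ⟨a, ha, b, hb, hab⟩ := h
  rw [Metric.isOpen_iff]
  intro x hx
  have h1 : (1 : ℝ) ∈ vectorSpan ℝ I := by
    have := Submodule.smul_mem _ (a - b)⁻¹ (vsub_mem_vectorSpan ℝ ha hb)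
    rwa [vsub_eq_sub, smul_eq_mul, inv_mul_cancel₀ (sub_ne_zero.2 hab)] at this
  obtain ⟨ε, hε, h⟩ := hI.add_smul_mem hx h1
  refine ⟨ε, hε, fun y hy => ?_⟩
  rw [Metric.mem_ball, Real.dist_eq] at hy
  simpa using h (y - x) hy.le

theorem IsRelOpenConvex.exists_finset_sum_eq_lineEuler {I : Set ℝ} (hI : IsRelOpenConvex I) :
    ∃ S : Finset ℝ, ∀ T : Finset ℝ, S ⊆ T →
      ∑ x ∈ T, ((if x ∈ I then (1 : ℝ) else 0) - if ∀ᶠ t in 𝓝[>] x, t ∈ I then 1 else 0)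
        - (if ∀ᶠ t in atBot, t ∈ I then 1 else 0) = lineEuler I := by
  unfold lineEuler
  by_cases h0 : I = ∅
  · subst h0
    have hbot : ∀ (f : Filter ℝ) [f.NeBot], ¬ ∀ᶠ t in f, t ∈ (∅ : Set ℝ) := fun f _ h =>
      h.exists.elim fun _ ht => ht
    exact ⟨∅, fun T _ => by simp only [hbot]; simp⟩
  obtain ⟨p, hp⟩ := Set.nonempty_iff_ne_empty.2 h0
  by_cases h1 : I.Subsingleton
  · obtain rfl : I = {p} := h1.eq_singleton_of_mem hp
    refine ⟨{p}, fun T hT => ?_⟩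
    have hT : p ∈ T := hT (by simp)
    have hplus : ∀ x : ℝ, ¬ ∀ᶠ t in 𝓝[>] x, t ∈ ({p} : Set ℝ) := by
      intro x hx
      obtain ⟨t, ht, hxt⟩ := (hx.and self_mem_nhdsWithin).exists
      obtain ⟨u, hu, _, hut⟩ := (hx.and (Ioo_mem_nhdsGT hxt)).exists
      simp only [Set.mem_singleton_iff] at ht hu
      linarith
    have hbot : ¬ ∀ᶠ t in atBot, t ∈ ({p} : Set ℝ) := by
      intro hx
      obtain ⟨t, ht, hpt⟩ := (hx.and (eventually_lt_atBot p)).exists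
      exact hpt.ne ht
    simp only [hplus, hbot]
    simp [hT]
  · have hopen := hI.isOpen_of_not_subsingleton h1
    have hin : ∀ x ∈ I, ∀ᶠ t in 𝓝[>] x, t ∈ I := fun x hx =>
      eventually_nhdsWithin_of_eventually_nhds (hopen.mem_nhds hx)
    by_cases hb : BddBelow I
    · set a := sInf I with ha
      have hglb : IsGLB I a := isGLB_csInf ⟨p, hp⟩ hb
      have haI : a ∉ I := by
        intro h
        obtain ⟨ε, hε, hball⟩ := Metric.isOpen_iff.1 hopen a h
        have : a - ε / 2 ∈ I := hball (by
          rw [Metric.mem_ball, Real.dist_eq, sub_sub_cancel_left, abs_neg,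
            abs_of_pos (half_pos hε)]
          exact half_lt_self hε)
        linarith [hglb.1 this]
      have hap : a < p := lt_of_le_of_ne (hglb.1 hp) fun h => haI (h ▸ hp)
      have haplus : ∀ᶠ t in 𝓝[>] a, t ∈ I := by
        filter_upwards [Ioo_mem_nhdsGT hap] with t ht
        obtain ⟨y, hy, -, hyt⟩ := hglb.exists_between ht.1
        exact hI.convex.mem_of_le_of_le hy hp hyt.le ht.2.le
      have hother : ∀ x, x ∉ I → x ≠ a → ¬ ∀ᶠ t in 𝓝[>] x, t ∈ I := by
        intro x hx hxa h
        rcases lt_or_gt_of_ne hxa with hlt | hgt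
        · obtain ⟨t, ht, -, hta⟩ := (h.and (Ioo_mem_nhdsGT hlt)).exists
          linarith [hglb.1 ht]
        · obtain ⟨t, ht, hxt⟩ := (h.and self_mem_nhdsWithin).exists
          obtain ⟨y, hy, -, hyx⟩ := hglb.exists_between hgt
          exact hx (hI.convex.mem_of_le_of_le hy ht hyx.le (le_of_lt hxt))
      have hbot : ¬ ∀ᶠ t in atBot, t ∈ I := by
        intro hx
        obtain ⟨t, ht, hpt⟩ := (hx.and (eventually_lt_atBot a)).exists
        linarith [hglb.1 ht]
      refine ⟨{a}, fun T hT => ?_⟩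
      have hT : a ∈ T := hT (by simp)
      have hterm : ∀ x ∈ T, ((if x ∈ I then (1 : ℝ) else 0) -
          if ∀ᶠ t in 𝓝[>] x, t ∈ I then 1 else 0) = if x = a then -1 else 0 := by
        intro x _
        by_cases hxa : x = a
        · subst hxa
          rw [if_neg haI, if_pos haplus]; simp
        · by_cases hx : x ∈ I
          · rw [if_pos hx, if_pos (hin x hx)]; simp [hxa]
          · rw [if_neg hx, if_neg (hother x hx hxa)]; simp [hxa]
      rw [Finset.sum_congr rfl hterm]
      simp [hT, hbot, h0, h1]
    · rw [not_bddBelow_iff] at hb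
      have hbot : ∀ᶠ t in atBot, t ∈ I := by
        filter_upwards [eventually_le_atBot p] with t ht
        obtain ⟨y, hy, hyt⟩ := hb t
        exact hI.convex.mem_of_le_of_le hy hp hyt.le ht
      have hplus : ∀ x, (∀ᶠ t in 𝓝[>] x, t ∈ I) ↔ x ∈ I := by
        refine fun x => ⟨fun h => ?_, hin x⟩
        obtain ⟨t, ht, hxt⟩ := (h.and self_mem_nhdsWithin).exists
        obtain ⟨y, hy, hyx⟩ := hb x
        exact hI.convex.mem_of_le_of_le hy ht hyx.le (le_of_lt hxt)
      exact ⟨∅, fun T _ => by simp [hplus, hbot, h0, h1]⟩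

theorem sum_mul_lineEuler_eq_zero {ι : Type*} (s : Finset ι) (I : ι → Set ℝ) (c : ι → ℝ)
    (hI : ∀ i ∈ s, IsRelOpenConvex (I i))
    (h : ∀ t, ∑ i ∈ s, c i * (if t ∈ I i then 1 else 0) = 0) :
    ∑ i ∈ s, c i * lineEuler (I i) = 0 := by
  choose! S hS using fun i hi => (hI i hi).exists_finset_sum_eq_lineEuler
  have key : ∀ i ∈ s, c i * lineEuler (I i) =
      ∑ x ∈ s.biUnion S, (c i * (if x ∈ I i then (1 : ℝ) else 0) -
        c i * if ∀ᶠ t in 𝓝[>] x, t ∈ I i then 1 else 0)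
        - c i * (if ∀ᶠ t in atBot, t ∈ I i then 1 else 0) := by
    intro i hi
    rw [← hS i hi _ (Finset.subset_biUnion_of_mem S hi), mul_sub, Finset.mul_sum]
    simp only [mul_sub]
  rw [Finset.sum_congr rfl key, Finset.sum_sub_distrib, Finset.sum_comm,
    sum_mul_ite_eventually s I c atBot (fun i hi => (hI i hi).convex.eventually_atBot) h, sub_zero]
  refine Finset.sum_eq_zero fun x _ => ?_
  rw [Finset.sum_sub_distrib, h x, zero_sub, neg_eq_zero]
  exact sum_mul_ite_eventually s I c _ (fun i hi => (hI i hi).convex.eventually_nhdsGT x) h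

end Line

section Euler

theorem IsRelOpenConvex.lineEuler_fiber {E : Type*} [AddCommGroup E] [Module ℝ E] {C : Set E}
    (hC : IsRelOpenConvex C) (v x : E) :
    lineEuler {t : ℝ | x + t • v ∈ C} =
      (if v ∈ vectorSpan ℝ C then -1 else 1) *
        if (ℝ ∙ v).mkQ x ∈ (ℝ ∙ v).mkQ '' C then 1 else 0 := by
  have hmem : (ℝ ∙ v).mkQ x ∈ (ℝ ∙ v).mkQ '' C ↔ {t : ℝ | x + t • v ∈ C}.Nonempty := by
    constructor
    · rintro ⟨y, hy, hyx⟩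
      rw [Submodule.mkQ_apply, Submodule.mkQ_apply, Submodule.Quotient.eq,
        Submodule.mem_span_singleton] at hyx
      obtain ⟨t, ht⟩ := hyx
      refine ⟨t, ?_⟩
      simpa [ht] using hy
    · rintro ⟨t, ht⟩
      refine ⟨_, ht, ?_⟩
      rw [Submodule.mkQ_apply, Submodule.mkQ_apply, Submodule.Quotient.eq,
        Submodule.mem_span_singleton]
      exact ⟨t, by simp⟩
  unfold lineEuler
  by_cases hne : {t : ℝ | x + t • v ∈ C}.Nonempty
  · rw [if_neg hne.ne_empty, if_pos (hmem.2 hne), mul_one]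
    have hiff : {t : ℝ | x + t • v ∈ C}.Subsingleton ↔ v ∉ vectorSpan ℝ C := by
      constructor
      · intro hs hvC
        obtain ⟨t, ht⟩ := hne
        obtain ⟨ε, hε, h⟩ := hC.add_smul_mem ht hvC
        have h2 : t + ε ∈ {t : ℝ | x + t • v ∈ C} := by
          have := h ε (abs_of_pos hε).le
          rwa [add_assoc, ← add_smul] at this
        have := hs ht h2
        linarith
      · intro hvC t ht u hu
        by_contra htu
        have := vsub_mem_vectorSpan (s := C) ℝ ht hu
        rw [vsub_eq_sub, add_sub_add_left_eq_sub, ← sub_smul] at this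
        exact hvC ((Submodule.smul_mem_iff _ (sub_ne_zero.2 htu)).1 this)
    by_cases hvC : v ∈ vectorSpan ℝ C <;> simp [hiff, hvC]
  · rw [if_pos (Set.not_nonempty_iff_eq_empty.1 hne), if_neg (hmem.not.2 hne), mul_zero]

theorem finrank_map_mkQ_span_singleton {E : Type*} [AddCommGroup E] [Module ℝ E]
    [FiniteDimensional ℝ E] {v : E} (hv : v ≠ 0) (W : Submodule ℝ E) :
    (if v ∈ W then (-1 : ℝ) else 1) * (-1) ^ Module.finrank ℝ (W.map (ℝ ∙ v).mkQ) =
      (-1) ^ Module.finrank ℝ W := by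
  have hrank := LinearMap.finrank_range_add_finrank_ker ((ℝ ∙ v).mkQ.domRestrict W)
  rw [LinearMap.range_domRestrict, LinearMap.ker_domRestrict, Submodule.ker_mkQ] at hrank
  by_cases h : v ∈ W
  · rw [(Submodule.comapSubtypeEquivOfLe ((Submodule.span_singleton_le_iff_mem _ _).2 h)).finrank_eq,
      finrank_span_singleton hv] at hrank
    rw [if_pos h, ← hrank, pow_succ']
  · have hbot : (ℝ ∙ v).comap W.subtype = ⊥ := by
      rw [eq_bot_iff]
      rintro ⟨x, hx⟩ hxv
      obtain ⟨t, rfl⟩ := Submodule.mem_span_singleton.1 hxv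
      rw [Submodule.mem_bot, Submodule.mk_eq_zero]
      by_contra ht
      exact h ((Submodule.smul_mem_iff _ (left_ne_zero_of_smul ht)).1 hx)
    rw [hbot, finrank_bot, add_zero] at hrank
    rw [if_neg h, one_mul, hrank]

theorem IsRelOpenConvex.sum_euler_eq_zero {ι : Type*} {E : Type*} [AddCommGroup E] [Module ℝ E]
    [FiniteDimensional ℝ E] (s : Finset ι) (C : ι → Set E) (c : ι → ℝ)
    (hC : ∀ i ∈ s, IsRelOpenConvex (C i))
    (h : ∀ x, ∑ i ∈ s, c i * (if x ∈ C i then 1 else 0) = 0) :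
    ∑ i ∈ s, c i * (if (C i).Nonempty then (-1) ^ Module.finrank ℝ (vectorSpan ℝ (C i)) else 0)
      = 0 := by
  induction hn : Module.finrank ℝ E generalizing E c with
  | zero =>
    have := Module.finrank_zero_iff.1 hn
    refine Eq.trans (Finset.sum_congr rfl fun i _ => ?_) (h 0)
    have h1 : (C i).Nonempty ↔ (0 : E) ∈ C i :=
      ⟨fun ⟨x, hx⟩ => Subsingleton.elim x 0 ▸ hx, fun h => ⟨_, h⟩⟩
    have h2 : Module.finrank ℝ (vectorSpan ℝ (C i)) = 0 :=
      Nat.le_zero.1 (hn ▸ Submodule.finrank_le _)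
    simp only [h1, h2, pow_zero]
  | succ n ih =>
    have : Nontrivial E := Module.nontrivial_of_finrank_pos (R := ℝ) (by omega)
    obtain ⟨v, hv⟩ := exists_ne (0 : E)
    have key := ih (E := E ⧸ (ℝ ∙ v)) (fun i => (ℝ ∙ v).mkQ '' C i)
      (c := fun i => c i * if v ∈ vectorSpan ℝ (C i) then -1 else 1)
      (fun i hi => (hC i hi).image _) ?_ ?_
    · refine Eq.trans (Finset.sum_congr rfl fun i _ => ?_) key
      have himage := (ℝ ∙ v).mkQ.toAffineMap.map_vectorSpan (s := C i)
      rw [LinearMap.coe_toAffineMap, LinearMap.toAffineMap_linear] at himage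
      rw [← himage, Set.image_nonempty, ← finrank_map_mkQ_span_singleton hv, mul_assoc]
      congr 1
      rw [mul_ite, mul_zero]
    · intro y
      obtain ⟨x, rfl⟩ := (ℝ ∙ v).mkQ_surjective y
      refine Eq.trans (Finset.sum_congr rfl fun i hi => ?_) (sum_mul_lineEuler_eq_zero s
        (fun i => {t : ℝ | x + t • v ∈ C i}) c (fun i hi => (hC i hi).fiber x v) fun t => h _)
      rw [(hC i hi).lineEuler_fiber, mul_assoc]
    · have := Submodule.finrank_quotient_add_finrank (ℝ ∙ v)
      rw [finrank_span_singleton hv] at this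
      omega

end Euler

section NormalCone

variable {E : Type*} [AddCommGroup E] [Module ℝ E]

/-- The points of `V` at which the linear form `l` attains its maximum over `V`. -/
def maxPoints (V : Finset E) (l : Module.Dual ℝ E) : Finset E :=
  V.filter fun v => ∀ u ∈ V, l u ≤ l v

/-- The open normal cone of `S`: the linear forms whose maximum over `V` is attained exactly
on `S`. -/
def openNormalCone (V S : Finset E) : Set (Module.Dual ℝ E) :=
  {l | maxPoints V l = S}

theorem mem_maxPoints {V : Finset E} {l : Module.Dual ℝ E} {v : E} :
    v ∈ maxPoints V l ↔ v ∈ V ∧ ∀ u ∈ V, l u ≤ l v :=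
  Finset.mem_filter

theorem maxPoints_nonempty {V : Finset E} (hV : V.Nonempty) (l : Module.Dual ℝ E) :
    (maxPoints V l).Nonempty := by
  obtain ⟨v, hv, h⟩ := V.exists_max_image l hV
  exact ⟨v, mem_maxPoints.2 ⟨hv, h⟩⟩

theorem maxPoints_eq_iff {V : Finset E} {l : Module.Dual ℝ E} {S : Finset E} {u : E}
    (hS : S ⊆ V) (hu : u ∈ S) :
    maxPoints V l = S ↔ (∀ v ∈ S, l v = l u) ∧ ∀ v ∈ V, v ∉ S → l v < l u := by
  constructor
  · rintro rfl
    have hu' := mem_maxPoints.1 hu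
    refine ⟨fun v hv => ?_, fun v hv hvS => ?_⟩
    · exact le_antisymm (hu'.2 v (hS hv)) ((mem_maxPoints.1 hv).2 u hu'.1)
    · refine lt_of_le_of_ne (hu'.2 v hv) fun h => hvS (mem_maxPoints.2 ⟨hv, ?_⟩)
      rw [h]
      exact hu'.2
  · rintro ⟨h₁, h₂⟩
    have hle : ∀ v ∈ V, l v ≤ l u := fun v hv => by
      by_cases hvS : v ∈ S
      · exact (h₁ v hvS).le
      · exact (h₂ v hv hvS).le
    ext v
    rw [mem_maxPoints]
    refine ⟨fun ⟨hv, hmax⟩ => ?_, fun hv => ⟨hS hv, by rw [h₁ v hv]; exact hle⟩⟩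
    by_contra hvS
    exact (h₂ v hv hvS).not_ge (hmax u (hS hu))

theorem exists_pos_forall_add_mul_lt {ι : Type*} (s : Finset ι) (a b c d : ι → ℝ)
    (h : ∀ i ∈ s, a i < b i) :
    ∃ ε : ℝ, 0 < ε ∧ ∀ δ : ℝ, |δ| ≤ ε → ∀ i ∈ s, a i + δ * c i < b i + δ * d i := by
  have : ∀ᶠ δ in nhds (0 : ℝ), ∀ i ∈ s, a i + δ * c i < b i + δ * d i := by
    rw [Filter.eventually_all_finset]
    intro i hi
    have hc : Continuous fun δ : ℝ => a i + δ * c i := by fun_prop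
    have hd : Continuous fun δ : ℝ => b i + δ * d i := by fun_prop
    exact (hc.continuousAt.eventually_lt hd.continuousAt (by simpa using h i hi))
  obtain ⟨ε, hε, h⟩ := Metric.eventually_nhds_iff.1 this
  refine ⟨ε / 2, half_pos hε, fun δ hδ => h ?_⟩
  rw [Real.dist_eq, sub_zero]
  linarith

theorem add_smul_mem_openNormalCone {V S : Finset E} {u : E} (hS : S ⊆ V) (hu : u ∈ S)
    {l w : Module.Dual ℝ E} (hl : l ∈ openNormalCone V S) (hw : ∀ v ∈ S, w v = w u) :
    ∃ ε : ℝ, 0 < ε ∧ ∀ δ : ℝ, |δ| ≤ ε → l + δ • w ∈ openNormalCone V S := by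
  obtain ⟨h₁, h₂⟩ := (maxPoints_eq_iff hS hu).1 hl
  obtain ⟨ε, hε, h⟩ := exists_pos_forall_add_mul_lt (V \ S) l (fun _ => l u) w (fun _ => w u)
    fun v hv => h₂ v (Finset.mem_sdiff.1 hv).1 (Finset.mem_sdiff.1 hv).2
  refine ⟨ε, hε, fun δ hδ => (maxPoints_eq_iff hS hu).2 ⟨fun v hv => ?_, fun v hv hvS => ?_⟩⟩
  · simp [h₁ v hv, hw v hv]
  · simpa using h δ hδ v (Finset.mem_sdiff.2 ⟨hv, hvS⟩)

theorem isRelOpenConvex_openNormalCone {V S : Finset E} (hS : S ⊆ V) (hne : S.Nonempty) :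
    IsRelOpenConvex (openNormalCone V S) := by
  obtain ⟨u, hu⟩ := hne
  constructor
  · intro l hl l' hl' a b ha hb hab
    obtain ⟨h₁, h₂⟩ := (maxPoints_eq_iff hS hu).1 hl
    obtain ⟨h₁', h₂'⟩ := (maxPoints_eq_iff hS hu).1 hl'
    refine (maxPoints_eq_iff hS hu).2 ⟨fun v hv => ?_, fun v hv hvS => ?_⟩
    · simp [h₁ v hv, h₁' v hv]
    · have := h₂ v hv hvS
      have := h₂' v hv hvS
      simp only [LinearMap.add_apply, LinearMap.smul_apply, smul_eq_mul]
      rcases ha.eq_or_lt with rfl | ha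
      · obtain rfl : b = 1 := by linarith
        linarith
      · nlinarith
  · intro l hl l' hl'
    obtain ⟨h₁, -⟩ := (maxPoints_eq_iff hS hu).1 hl
    obtain ⟨h₁', -⟩ := (maxPoints_eq_iff hS hu).1 hl'
    obtain ⟨ε, hε, h⟩ := add_smul_mem_openNormalCone hS hu hl (w := l - l') fun v hv => by
      simp [h₁ v hv, h₁' v hv]
    exact ⟨ε, hε, h ε (abs_of_pos hε).le⟩

theorem vectorSpan_openNormalCone {V S : Finset E} (hS : S ⊆ V) (hne : S.Nonempty)
    (hN : (openNormalCone V S).Nonempty) :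
    vectorSpan ℝ (openNormalCone V S) = (vectorSpan ℝ (S : Set E)).dualAnnihilator := by
  obtain ⟨u, hu⟩ := hne
  apply le_antisymm
  · rw [vectorSpan_def, Submodule.span_le]
    rintro _ ⟨l, hl, l', hl', rfl⟩
    obtain ⟨h₁, -⟩ := (maxPoints_eq_iff hS hu).1 hl
    obtain ⟨h₁', -⟩ := (maxPoints_eq_iff hS hu).1 hl'
    rw [SetLike.mem_coe, Submodule.mem_dualAnnihilator]
    suffices vectorSpan ℝ (S : Set E) ≤ LinearMap.ker (l - l') from fun w hw => this hw
    rw [vectorSpan_def, Submodule.span_le]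
    rintro _ ⟨v, hv, v', hv', rfl⟩
    simp [h₁ v hv, h₁' v hv, h₁ v' hv', h₁' v' hv']
  · intro w hw
    rw [Submodule.mem_dualAnnihilator] at hw
    obtain ⟨l, hl⟩ := hN
    obtain ⟨ε, hε, h⟩ := add_smul_mem_openNormalCone hS hu hl (w := w) fun v hv => by
      have := hw _ (vsub_mem_vectorSpan ℝ (Finset.mem_coe.2 hv) (Finset.mem_coe.2 hu))
      rwa [vsub_eq_sub, map_sub, sub_eq_zero] at this
    exact mem_vectorSpan_of_add_smul_mem hl hε (h ε (abs_of_pos hε).le)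

/-- The vertex sets of the nonempty exposed faces of the convex hull of `V`. -/
def faceVertexSets (V : Finset E) : Finset (Finset E) :=
  V.powerset.filter fun S => (openNormalCone V S).Nonempty

theorem maxPoints_mem_faceVertexSets (V : Finset E) (l : Module.Dual ℝ E) :
    maxPoints V l ∈ faceVertexSets V :=
  Finset.mem_filter.2 ⟨Finset.mem_powerset.2 (Finset.filter_subset _ _), l, rfl⟩

theorem sum_faceVertexSets_of_isAlgOpen [FiniteDimensional ℝ E] {V : Finset E} (hV : V.Nonempty)
    {U : Set (Module.Dual ℝ E)} (hU : IsAlgOpen U) (hc : Convex ℝ U) (hne : U.Nonempty) :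
    ∑ S ∈ faceVertexSets V, (-1 : ℝ) ^ Module.finrank ℝ (vectorSpan ℝ (S : Set E)) *
      (if (openNormalCone V S ∩ U).Nonempty then 1 else 0) = 1 := by
  have hface : ∀ S ∈ faceVertexSets V, S ⊆ V ∧ S.Nonempty ∧ (openNormalCone V S).Nonempty := by
    intro S hS
    obtain ⟨hSV, l, hl⟩ := Finset.mem_filter.1 hS
    exact ⟨Finset.mem_powerset.1 hSV, hl ▸ maxPoints_nonempty hV l, l, hl⟩
  have key := IsRelOpenConvex.sum_euler_eq_zero (Finset.insertNone (faceVertexSets V))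
    (fun o => o.elim U fun S => openNormalCone V S ∩ U) (fun o => o.elim (-1) fun _ => 1) ?_ ?_
  · rw [Finset.sum_insertNone] at key
    replace key : -1 * (if U.Nonempty then (-1 : ℝ) ^ Module.finrank ℝ (vectorSpan ℝ U) else 0) +
        ∑ S ∈ faceVertexSets V, 1 * (if (openNormalCone V S ∩ U).Nonempty then
          (-1 : ℝ) ^ Module.finrank ℝ (vectorSpan ℝ (openNormalCone V S ∩ U)) else 0) = 0 := key
    simp only [one_mul] at key
    rw [if_pos hne, hU.vectorSpan_eq_top hne, finrank_top, Subspace.dual_finrank_eq] at key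
    have hterm : ∀ S ∈ faceVertexSets V,
        (if (openNormalCone V S ∩ U).Nonempty then
          (-1 : ℝ) ^ Module.finrank ℝ (vectorSpan ℝ (openNormalCone V S ∩ U)) else 0) =
        (-1) ^ Module.finrank ℝ E * ((-1 : ℝ) ^ Module.finrank ℝ (vectorSpan ℝ (S : Set E)) *
          (if (openNormalCone V S ∩ U).Nonempty then 1 else 0)) := by
      intro S hS
      obtain ⟨hSV, hSne, hN⟩ := hface S hS
      split_ifs with h
      · rw [(isRelOpenConvex_openNormalCone hSV hSne).vectorSpan_inter hU h,
          vectorSpan_openNormalCone hSV hSne hN,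
          ← Subspace.finrank_add_finrank_dualAnnihilator_eq (vectorSpan ℝ (S : Set E)), mul_one,
          pow_add, mul_right_comm, ← mul_pow]
        simp
      · simp
    rw [Finset.sum_congr rfl hterm, ← Finset.mul_sum] at key
    have hpow : (-1 : ℝ) ^ Module.finrank ℝ E ≠ 0 := by simp
    refine mul_left_cancel₀ hpow ?_
    linarith
  · rintro (_ | S) hS
    · exact hU.isRelOpenConvex hc
    · obtain ⟨hSV, hSne, -⟩ := hface S (Finset.some_mem_insertNone.1 hS)
      exact (isRelOpenConvex_openNormalCone hSV hSne).inter hU hc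
  · intro l
    simp only [Finset.sum_insertNone, Option.elim_none, Option.elim_some, one_mul]
    by_cases hl : l ∈ U
    · have : ∀ S, l ∈ openNormalCone V S ∩ U ↔ maxPoints V l = S := fun S =>
        ⟨fun h => h.1, fun h => ⟨h, hl⟩⟩
      simp [this, hl, maxPoints_mem_faceVertexSets]
    · simp [hl]

end NormalCone

section Farkas

variable {E : Type*} [AddCommGroup E] [Module ℝ E]

theorem exists_nonneg_sum_smul_or_exists_separating {ι : Type*} (s : Finset ι) (a : ι → E) (b : E) :
    (∃ c : ι → ℝ, (∀ i ∈ s, 0 ≤ c i) ∧ b = ∑ i ∈ s, c i • a i) ∨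
      ∃ l : Module.Dual ℝ E, (∀ i ∈ s, l (a i) ≤ 0) ∧ 0 < l b := by
  induction s using Finset.induction_on generalizing a b with
  | empty =>
    by_cases hb : b = 0
    · exact Or.inl ⟨0, by simp, by simp [hb]⟩
    · obtain ⟨l, hl⟩ := not_forall.1 ((Module.forall_dual_apply_eq_zero_iff ℝ b).not.2 hb)
      exact Or.inr ⟨l b • l, by simp, mul_self_pos.2 hl⟩
  | insert j s hj ih =>
    have hinsert : ∀ (c : ι → ℝ) (r : ℝ), ∑ i ∈ insert j s, Function.update c j r i • a i =
        r • a j + ∑ i ∈ s, c i • a i := by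
      intro c r
      rw [Finset.sum_insert hj, Function.update_self]
      congr 1
      refine Finset.sum_congr rfl fun i hi => ?_
      rw [Function.update_of_ne (ne_of_mem_of_not_mem hi hj)]
    have hnonneg : ∀ (c : ι → ℝ) (r : ℝ), (∀ i ∈ s, 0 ≤ c i) → 0 ≤ r →
        ∀ i ∈ insert j s, 0 ≤ Function.update c j r i := by
      intro c r hc hr i hi
      rcases Finset.mem_insert.1 hi with rfl | hi
      · simpa using hr
      · rw [Function.update_of_ne (ne_of_mem_of_not_mem hi hj)]
        exact hc i hi
    rcases ih a b with ⟨c, hc, rfl⟩ | ⟨l, hl, hlb⟩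
    · exact Or.inl ⟨Function.update c j 0, hnonneg c 0 hc le_rfl, by simp [hinsert]⟩
    rcases le_or_gt (l (a j)) 0 with hlj | hlj
    · refine Or.inr ⟨l, fun i hi => ?_, hlb⟩
      rcases Finset.mem_insert.1 hi with rfl | hi
      exacts [hlj, hl i hi]
    rcases ih (fun i => a i - (l (a i) / l (a j)) • a j) (b - (l b / l (a j)) • a j) with
      ⟨c, hc, h⟩ | ⟨m, hm, hmb⟩
    · refine Or.inl ⟨Function.update c j (l b / l (a j) - ∑ i ∈ s, c i * (l (a i) / l (a j))),
        hnonneg _ _ hc ?_, ?_⟩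
      · have h₁ : ∑ i ∈ s, c i * (l (a i) / l (a j)) ≤ 0 := Finset.sum_nonpos fun i hi =>
          mul_nonpos_of_nonneg_of_nonpos (hc i hi) (div_nonpos_of_nonpos_of_nonneg (hl i hi) hlj.le)
        have h₂ : 0 < l b / l (a j) := by positivity
        linarith
      · simp only [smul_sub, Finset.sum_sub_distrib, smul_smul, ← Finset.sum_smul] at h
        rw [hinsert, sub_smul]
        refine (eq_add_of_sub_eq h).trans ?_
        abel
    · refine Or.inr ⟨m - (m (a j) / l (a j)) • l, fun i hi => ?_, ?_⟩
      · rcases Finset.mem_insert.1 hi with rfl | hi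
        · simp [hlj.ne']
        · have := hm i hi
          simp only [map_sub, map_smul, smul_eq_mul] at this
          simp only [LinearMap.sub_apply, LinearMap.smul_apply, smul_eq_mul]
          convert this using 2
          ring
      · simp only [map_sub, map_smul, smul_eq_mul] at hmb
        simp only [LinearMap.sub_apply, LinearMap.smul_apply, smul_eq_mul]
        convert hmb using 2
        ring

end Farkas

section Polytope

variable {E : Type*} [NormedAddCommGroup E] [NormedSpace ℝ E]

theorem le_of_mem_convexHull {V : Finset E} {l : Module.Dual ℝ E} {m : ℝ}
    (h : ∀ v ∈ V, l v ≤ m) {x : E} (hx : x ∈ convexHull ℝ (V : Set E)) : l x ≤ m :=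
  convexHull_min (t := {y | l y ≤ m}) (fun v hv => h v hv) (convex_halfSpace_le l.isLinear m) hx

theorem apply_eq_of_mem_convexHull {V : Finset E} {l : Module.Dual ℝ E} {m : ℝ}
    (h : ∀ v ∈ V, l v = m) {x : E} (hx : x ∈ convexHull ℝ (V : Set E)) : l x = m :=
  convexHull_min (t := {y | l y = m}) (fun v hv => h v hv) (convex_hyperplane l.isLinear m) hx

theorem setOf_isMax_eq_convexHull_maxPoints {V : Finset E} (hV : V.Nonempty)
    (l : Module.Dual ℝ E) :
    {x ∈ convexHull ℝ (V : Set E) | ∀ y ∈ convexHull ℝ (V : Set E), l y ≤ l x} =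
      convexHull ℝ (maxPoints V l : Set E) := by
  obtain ⟨u, hu⟩ := maxPoints_nonempty hV l
  have hsub : maxPoints V l ⊆ V := Finset.filter_subset _ _
  obtain ⟨heq, hlt⟩ := (maxPoints_eq_iff hsub hu).1 rfl
  have hmax := (mem_maxPoints.1 hu).2
  ext x
  constructor
  · rintro ⟨hx, hxmax⟩
    have hlx : l x = l u :=
      le_antisymm (le_of_mem_convexHull hmax hx) (hxmax u (subset_convexHull ℝ _ (hsub hu)))
    obtain ⟨w, hw, hw1, hwx⟩ := Finset.mem_convexHull'.1 hx
    have hsum : ∑ v ∈ V, w v * (l u - l v) = 0 := by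
      simp only [mul_sub, Finset.sum_sub_distrib, ← Finset.sum_mul, hw1]
      rw [← hlx, ← hwx, map_sum]
      simp
    have hzero : ∀ v ∈ V, v ∉ maxPoints V l → w v = 0 := by
      intro v hv hvM
      have h := (Finset.sum_eq_zero_iff_of_nonneg fun v hv =>
        mul_nonneg (hw v hv) (sub_nonneg.2 (hmax v hv))).1 hsum v hv
      exact (mul_eq_zero.1 h).resolve_right (sub_ne_zero.2 (hlt v hv hvM).ne')
    refine Finset.mem_convexHull'.2 ⟨w, fun v hv => hw v (hsub hv), ?_, ?_⟩
    · rw [Finset.sum_subset hsub hzero, hw1]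
    · rw [Finset.sum_subset hsub fun v hv hvM => by rw [hzero v hv hvM, zero_smul], hwx]
  · intro hx
    refine ⟨convexHull_mono (Finset.coe_subset.2 hsub) hx, fun y hy => ?_⟩
    rw [apply_eq_of_mem_convexHull heq hx]
    exact le_of_mem_convexHull hmax hy

theorem injOn_convexHull_faceVertexSets {V : Finset E} (hV : V.Nonempty) :
    Set.InjOn (fun S : Finset E => convexHull ℝ (S : Set E)) (faceVertexSets V) := by
  have key : ∀ S ∈ faceVertexSets V, ∀ v, v ∈ S ↔ v ∈ V ∧ v ∈ convexHull ℝ (S : Set E) := by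
    intro S hS v
    obtain ⟨-, l, rfl⟩ := Finset.mem_filter.1 hS
    refine ⟨fun hv => ⟨(mem_maxPoints.1 hv).1, subset_convexHull ℝ _ hv⟩, fun ⟨hv, hvS⟩ => ?_⟩
    rw [← setOf_isMax_eq_convexHull_maxPoints hV] at hvS
    exact mem_maxPoints.2 ⟨hv, fun u hu => hvS.2 u (subset_convexHull ℝ _ hu)⟩
  intro S hS T hT hST
  ext v
  rw [key S hS, key T hT]
  simp only at hST
  rw [hST]

theorem vectorSpan_convexHull_eq (S : Set E) : vectorSpan ℝ (convexHull ℝ S) = vectorSpan ℝ S := by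
  rw [← direction_affineSpan, affineSpan_convexHull, direction_affineSpan]

theorem apply_eq_of_mem_intrinsicInterior {F : Set E} (l : Module.Dual ℝ E) {x : E}
    (hx : x ∈ intrinsicInterior ℝ F) (h : ∀ y ∈ F, l y ≤ l x) {y : E} (hy : y ∈ F) :
    l y = l x := by
  obtain ⟨⟨x', hx'⟩, hx_mem, rfl⟩ := mem_intrinsicInterior.1 hx
  refine le_antisymm (h y hy) ?_
  have hmem : ∀ t : ℝ, AffineMap.lineMap x' y t ∈ affineSpan ℝ F := fun t =>
    AffineMap.lineMap_mem t hx' (subset_affineSpan ℝ F hy)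
  have hcont : Continuous fun t : ℝ => (⟨AffineMap.lineMap x' y t, hmem t⟩ : affineSpan ℝ F) :=
    AffineMap.lineMap_continuous.subtype_mk _
  have h0 : (⟨AffineMap.lineMap x' y (0 : ℝ), hmem 0⟩ : affineSpan ℝ F) = ⟨x', hx'⟩ := by simp
  have hev : ∀ᶠ t in nhds (0 : ℝ), AffineMap.lineMap x' y t ∈ F := by
    have := hcont.continuousAt.eventually_mem (x := (0 : ℝ))
      (by rw [h0]; exact mem_interior_iff_mem_nhds.1 hx_mem)
    exact this
  obtain ⟨t, ht, htF⟩ := ((eventually_nhdsWithin_of_eventually_nhds hev).and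
    (self_mem_nhdsWithin : Set.Iio (0 : ℝ) ∈ nhdsWithin 0 (Set.Iio 0))).exists
  have h1 := h _ ht
  rw [AffineMap.lineMap_apply_module', map_add, map_smul, map_sub, smul_eq_mul] at h1
  have h2 : t < 0 := htF
  nlinarith

/-- The set of points seen from a relative interior point of `F` in the direction of `P`. -/
def tangentCone (P F : Set E) : Set E :=
  {y | ∃ x₀ ∈ intrinsicInterior ℝ F, ∃ t : ℝ, 0 < t ∧ x₀ + t • (y - x₀) ∈ P}

/-- The linear forms that are larger at `z` than at every point of `V`. -/
def separatingForms (V : Finset E) (z : E) : Set (Module.Dual ℝ E) :=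
  {l | ∀ v ∈ V, l v < l z}

theorem isAlgOpen_separatingForms (V : Finset E) (z : E) : IsAlgOpen (separatingForms V z) := by
  intro l hl w
  obtain ⟨ε, hε, h⟩ := exists_pos_forall_add_mul_lt V l (fun _ => l z) w (fun _ => w z) hl
  exact ⟨ε, hε, fun δ hδ v hv => h δ hδ v hv⟩

theorem convex_separatingForms (V : Finset E) (z : E) : Convex ℝ (separatingForms V z) := by
  intro l hl l' hl' a b ha hb hab v hv
  have h := hl v hv
  have h' := hl' v hv
  simp only [LinearMap.add_apply, LinearMap.smul_apply, smul_eq_mul]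
  rcases ha.eq_or_lt with rfl | ha
  · obtain rfl : b = 1 := by linarith
    linarith
  · nlinarith

theorem separatingForms_nonempty_iff {V : Finset E} {z : E} :
    (separatingForms V z).Nonempty ↔ z ∉ convexHull ℝ (V : Set E) := by
  constructor
  · rintro ⟨l, hl⟩ hz
    obtain ⟨v, hv, hmax⟩ := V.exists_max_image l
      (Finset.coe_nonempty.1 (convexHull_nonempty_iff.1 ⟨z, hz⟩))
    exact (le_of_mem_convexHull hmax hz).not_gt (hl v hv)
  · intro hz
    obtain ⟨l, m, hl, hm⟩ := geometric_hahn_banach_closed_point (convex_convexHull ℝ _)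
      (V.finite_toSet.isCompact_convexHull (𝕜 := ℝ)).isClosed hz
    exact ⟨l.toLinearMap, fun v hv => (hl v (subset_convexHull ℝ _ hv)).trans hm⟩

variable [FiniteDimensional ℝ E]

theorem mem_tangentCone_iff {V : Finset E} (hV : V.Nonempty) {l₀ : Module.Dual ℝ E} {z : E} :
    z ∈ tangentCone (convexHull ℝ (V : Set E)) (convexHull ℝ (maxPoints V l₀ : Set E)) ↔
      ¬ (openNormalCone V (maxPoints V l₀) ∩ separatingForms V z).Nonempty := by
  set S := maxPoints V l₀ with hSdef
  have hSV : S ⊆ V := Finset.filter_subset _ _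
  obtain ⟨u, hu⟩ : S.Nonempty := maxPoints_nonempty hV l₀
  constructor
  · rintro ⟨x₀, hx₀, t, ht, h⟩ ⟨l, hl, hlz⟩
    obtain ⟨h₁, -⟩ := (maxPoints_eq_iff hSV hu).1 hl
    have hx := apply_eq_of_mem_convexHull h₁ (intrinsicInterior_subset hx₀)
    have hux : l (x₀ + t • (z - x₀)) ≤ l u := by
      refine le_of_mem_convexHull (fun v hv => ?_) h
      have hu' : u ∈ maxPoints V l := by rw [show maxPoints V l = S from hl]; exact hu
      exact (mem_maxPoints.1 hu').2 v hv
    rw [map_add, map_smul, map_sub, smul_eq_mul, hx] at hux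
    have := hlz u (hSV hu)
    nlinarith
  · intro hN
    obtain ⟨x₀, hx₀⟩ : (intrinsicInterior ℝ (convexHull ℝ (S : Set E))).Nonempty :=
      Set.Nonempty.intrinsicInterior (convex_convexHull ℝ _) ⟨u, subset_convexHull ℝ _ hu⟩
    have hx₀V : x₀ ∈ convexHull ℝ (V : Set E) :=
      convexHull_mono (Finset.coe_subset.2 hSV) (intrinsicInterior_subset hx₀)
    refine ⟨x₀, hx₀, ?_⟩
    rcases exists_nonneg_sum_smul_or_exists_separating V (fun v => v - x₀) (z - x₀) with
      ⟨c, hc, h⟩ | ⟨l, hl, hlz⟩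
    · rcases (Finset.sum_nonneg hc).eq_or_lt with h0 | hpos
      · refine ⟨1, one_pos, ?_⟩
        have hzero := (Finset.sum_eq_zero_iff_of_nonneg hc).1 h0.symm
        rw [h, Finset.sum_eq_zero fun v hv => by rw [hzero v hv, zero_smul]]
        simpa using hx₀V
      · refine ⟨(∑ v ∈ V, c v)⁻¹, inv_pos.2 hpos, Finset.mem_convexHull'.2
          ⟨fun v => (∑ v ∈ V, c v)⁻¹ * c v, fun v hv => mul_nonneg (inv_pos.2 hpos).le (hc v hv),
            ?_, ?_⟩⟩
        · rw [← Finset.mul_sum, inv_mul_cancel₀ hpos.ne']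
        · simp only [mul_smul, ← Finset.smul_sum]
          rw [h]
          simp only [smul_sub, Finset.sum_sub_distrib, ← Finset.sum_smul]
          rw [smul_smul, inv_mul_cancel₀ hpos.ne', one_smul]
          abel
    · refine absurd ?_ hN
      have hlV : ∀ v ∈ V, l v ≤ l x₀ := fun v hv => by simpa using hl v hv
      have hconst : ∀ v ∈ S, l v = l x₀ := fun v hv =>
        apply_eq_of_mem_intrinsicInterior l hx₀
          (fun y hy => le_of_mem_convexHull (fun v hv => hlV v (hSV hv)) hy)
          (subset_convexHull ℝ _ hv)
      obtain ⟨h₁, h₂⟩ := (maxPoints_eq_iff hSV hu).1 hSdef.symm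
      have hlz' : l u < l z := by
        rw [hconst u hu]; simpa using hlz
      obtain ⟨ε, hε, hεlt⟩ := exists_pos_forall_add_mul_lt {()} (fun _ => l u) (fun _ => l z)
        (fun _ => l₀ u) (fun _ => l₀ z) fun _ _ => hlz'
      have hz := hεlt ε (abs_of_pos hε).le () (by simp)
      have hmem : l + ε • l₀ ∈ openNormalCone V S := by
        refine (maxPoints_eq_iff hSV hu).2 ⟨fun v hv => ?_, fun v hv hvS => ?_⟩
        · simp [hconst v hv, hconst u hu, h₁ v hv]
        · have := hlV v hv
          rw [← hconst u hu] at this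
          have := h₂ v hv hvS
          simp only [LinearMap.add_apply, LinearMap.smul_apply, smul_eq_mul]
          nlinarith
      refine ⟨_, hmem, fun v hv => ?_⟩
      have hu' : u ∈ maxPoints V (l + ε • l₀) := by
        rw [show maxPoints V (l + ε • l₀) = S from hmem]; exact hu
      exact ((mem_maxPoints.1 hu').2 v hv).trans_lt (by simpa using hz)

theorem setOf_exposed_eq_image_faceVertexSets {V : Finset E} (hV : V.Nonempty) :
    {F : Set E | IsExposed ℝ (convexHull ℝ (V : Set E)) F ∧ F.Nonempty} =
      (fun S : Finset E => convexHull ℝ (S : Set E)) '' (faceVertexSets V) := by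
  ext F
  constructor
  · rintro ⟨hF, hne⟩
    obtain ⟨l, rfl⟩ := hF hne
    exact ⟨_, maxPoints_mem_faceVertexSets V l.toLinearMap,
      (setOf_isMax_eq_convexHull_maxPoints hV l.toLinearMap).symm⟩
  · rintro ⟨S, hS, rfl⟩
    obtain ⟨-, l, rfl⟩ := Finset.mem_filter.1 hS
    refine ⟨fun _ => ⟨LinearMap.toContinuousLinearMap l, ?_⟩, ?_⟩
    · exact (setOf_isMax_eq_convexHull_maxPoints hV l).symm
    · exact convexHull_nonempty_iff.2 (maxPoints_nonempty hV l)

/-- The **Brianchon–Gram** identity for the convex hull of a nonempty finite set. -/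
theorem finsum_exposed_tangentCone {V : Finset E} (hV : V.Nonempty) (z : E) :
    (∑ᶠ F ∈ {F : Set E | IsExposed ℝ (convexHull ℝ (V : Set E)) F ∧ F.Nonempty},
      (-1 : ℝ) ^ Module.finrank ℝ (vectorSpan ℝ F) *
        (if z ∈ tangentCone (convexHull ℝ (V : Set E)) F then 1 else 0)) =
      if z ∈ convexHull ℝ (V : Set E) then 1 else 0 := by
  rw [setOf_exposed_eq_image_faceVertexSets hV,
    finsum_mem_image (injOn_convexHull_faceVertexSets hV), finsum_mem_coe_finset]
  have huniv := sum_faceVertexSets_of_isAlgOpen hV (U := Set.univ)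
    (fun _ _ _ => ⟨1, one_pos, fun _ _ => trivial⟩) convex_univ Set.univ_nonempty
  have hterm : ∀ S ∈ faceVertexSets V,
      (-1 : ℝ) ^ Module.finrank ℝ (vectorSpan ℝ (convexHull ℝ (S : Set E))) *
        (if z ∈ tangentCone (convexHull ℝ (V : Set E)) (convexHull ℝ (S : Set E)) then 1 else 0) =
      (-1 : ℝ) ^ Module.finrank ℝ (vectorSpan ℝ (S : Set E)) *
          (if (openNormalCone V S ∩ Set.univ).Nonempty then 1 else 0) -
        (-1 : ℝ) ^ Module.finrank ℝ (vectorSpan ℝ (S : Set E)) *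
          (if (openNormalCone V S ∩ separatingForms V z).Nonempty then 1 else 0) := by
    intro S hS
    obtain ⟨-, l, rfl⟩ := Finset.mem_filter.1 hS
    have hN : (openNormalCone V (maxPoints V l) ∩ Set.univ).Nonempty := ⟨l, rfl, trivial⟩
    rw [vectorSpan_convexHull_eq, if_pos hN]
    simp only [mem_tangentCone_iff hV]
    split_ifs <;> simp
  rw [Finset.sum_congr rfl hterm, Finset.sum_sub_distrib, huniv]
  by_cases hz : z ∈ convexHull ℝ (V : Set E)
  · have hempty : separatingForms V z = ∅ :=
      Set.not_nonempty_iff_eq_empty.1 fun h => separatingForms_nonempty_iff.1 h hz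
    simp [hz, hempty]
  · rw [sum_faceVertexSets_of_isAlgOpen hV (isAlgOpen_separatingForms V z)
      (convex_separatingForms V z) (separatingForms_nonempty_iff.2 hz), if_neg hz, sub_self]

end Polytope

/-- **Brianchon–Gram.** For a full-dimensional polytope `P ⊂ ℝ^d` and
every `z ∈ ℝ^d`, `Σ_F (-1)^{dim F} 1_{K_F}(z) = 1_P(z)`, where `F` runs over the nonempty
(exposed) faces of `P` (including `P` itself) and `K_F` is the tangent cone of `F`. -/
theorem statement17 (d : ℕ) (V : Finset (Fin d → ℝ))
    (hfull : (interior (convexHull ℝ (V : Set (Fin d → ℝ)))).Nonempty) :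
    ∀ z : Fin d → ℝ,
      (∑ᶠ F ∈ {F : Set (Fin d → ℝ) |
          IsExposed ℝ (convexHull ℝ (V : Set (Fin d → ℝ))) F ∧ F.Nonempty},
        (-1 : ℝ) ^ (Module.finrank ℝ (vectorSpan ℝ F)) *
          (if z ∈ {y | ∃ x₀ ∈ intrinsicInterior ℝ F, ∃ t : ℝ, 0 < t ∧
              x₀ + t • (y - x₀) ∈ convexHull ℝ (V : Set (Fin d → ℝ))} then 1 else 0)) =
      (if z ∈ convexHull ℝ (V : Set (Fin d → ℝ)) then (1 : ℝ) else 0) := by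
  intro z
  have hV : V.Nonempty :=
    Finset.coe_nonempty.1 (convexHull_nonempty_iff.1 (hfull.mono interior_subset))
  exact finsum_exposed_tangentCone hV z

end
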